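/- arXiv:1001.4698 — 2 statements merged into one kernel-verified Lean document; each statement's English description precedes it below -/
import Mathlib

section
/- Let ρ₀ > 0, 0 < φ < π/2, b₀ := ρ₀ tan φ, 0 ≤ ρ₁ < ρ₀, d₁ := arccos(ρ₁/√(ρ₀² + b₀²)) − φ, a_I := √(ρ₀² + b₀²) cos(d₁/2 + φ), b_I := √(ρ₀² + b₀²) sin(d₁/2 + φ). For ν ∈ [−d₁/2, d₁/2] define a(ν) := a_I cos ν + b_I sin ν and b(ν) := b_I cos ν − a_I sin ν. Then a(ν) = √(ρ₀² + b₀²) cos(d₁/2 + φ − ν), b(ν) = √(ρ₀² + b₀²) sin(d₁/2 + φ − ν), and moreover ρ₁ ≤ a(ν) ≤ ρ₀ and b₀ ≤ b(ν) ≤ √(b₀² + ρ₀² − ρ₁²) for all ν ∈ [−d₁/2, d₁/2]. -/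
open Real

/-- Properties of the parameters `a(ν) = a_I cos ν + b_I sin ν`, `b(ν) = b_I cos ν - a_I sin ν`
of the translated hyperbolas, for `ν ∈ [-d₁/2, d₁/2]`. -/
theorem stmt_10 (ρ₀ φ b₀ ρ₁ d₁ aI bI : ℝ) (hρ₀ : 0 < ρ₀) (hφ0 : 0 < φ) (hφ : φ < π / 2)
    (hb₀ : b₀ = ρ₀ * Real.tan φ) (hρ₁0 : 0 ≤ ρ₁) (hρ₁ : ρ₁ < ρ₀)
    (hd₁ : d₁ = Real.arccos (ρ₁ / Real.sqrt (ρ₀ ^ 2 + b₀ ^ 2)) - φ)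
    (haI : aI = Real.sqrt (ρ₀ ^ 2 + b₀ ^ 2) * Real.cos (d₁ / 2 + φ))
    (hbI : bI = Real.sqrt (ρ₀ ^ 2 + b₀ ^ 2) * Real.sin (d₁ / 2 + φ)) :
    ∀ ν ∈ Set.Icc (-(d₁ / 2)) (d₁ / 2),
      aI * Real.cos ν + bI * Real.sin ν
          = Real.sqrt (ρ₀ ^ 2 + b₀ ^ 2) * Real.cos (d₁ / 2 + φ - ν) ∧
      bI * Real.cos ν - aI * Real.sin ν
          = Real.sqrt (ρ₀ ^ 2 + b₀ ^ 2) * Real.sin (d₁ / 2 + φ - ν) ∧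
      ρ₁ ≤ aI * Real.cos ν + bI * Real.sin ν ∧
      aI * Real.cos ν + bI * Real.sin ν ≤ ρ₀ ∧
      b₀ ≤ bI * Real.cos ν - aI * Real.sin ν ∧
      bI * Real.cos ν - aI * Real.sin ν ≤ Real.sqrt (b₀ ^ 2 + ρ₀ ^ 2 - ρ₁ ^ 2) := by
  intro ν hν
  obtain ⟨h1, h2⟩ := hν
  have hc : 0 < Real.cos φ := Real.cos_pos_of_mem_Ioo ⟨by linarith, hφ⟩
  have hR2 : ρ₀ ^ 2 + b₀ ^ 2 = (ρ₀ / Real.cos φ) ^ 2 := by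
    rw [hb₀, Real.tan_eq_sin_div_cos]
    field_simp
    linarith [Real.sin_sq_add_cos_sq φ]
  have hR : Real.sqrt (ρ₀ ^ 2 + b₀ ^ 2) = ρ₀ / Real.cos φ := by
    rw [hR2]
    exact Real.sqrt_sq (by positivity)
  have hRsq : Real.sqrt (ρ₀ ^ 2 + b₀ ^ 2) ^ 2 = ρ₀ ^ 2 + b₀ ^ 2 :=
    Real.sq_sqrt (by positivity)
  have hRpos : 0 < Real.sqrt (ρ₀ ^ 2 + b₀ ^ 2) := by rw [hR]; positivity
  have hRc : Real.sqrt (ρ₀ ^ 2 + b₀ ^ 2) * Real.cos φ = ρ₀ := by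
    rw [hR]; field_simp
  have hRs : Real.sqrt (ρ₀ ^ 2 + b₀ ^ 2) * Real.sin φ = b₀ := by
    rw [hR, hb₀, Real.tan_eq_sin_div_cos]; field_simp
  generalize Real.sqrt (ρ₀ ^ 2 + b₀ ^ 2) = R at *
  have hq0 : 0 ≤ ρ₁ / R := by positivity
  have hq1 : ρ₁ / R ≤ 1 := by
    rw [div_le_one hRpos]
    nlinarith [Real.cos_le_one φ]
  have hA : Real.arccos (ρ₁ / R) ≤ π / 2 := Real.arccos_le_pi_div_two.2 hq0
  have hcA : R * Real.cos (Real.arccos (ρ₁ / R)) = ρ₁ := by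
    rw [Real.cos_arccos (by linarith) hq1]; field_simp
  have ea : aI * Real.cos ν + bI * Real.sin ν = R * Real.cos (d₁ / 2 + φ - ν) := by
    rw [Real.cos_sub, haI, hbI]; ring
  have eb : bI * Real.cos ν - aI * Real.sin ν = R * Real.sin (d₁ / 2 + φ - ν) := by
    rw [Real.sin_sub, haI, hbI]; ring
  rw [ea, eb]
  have t1 : φ ≤ d₁ / 2 + φ - ν := by linarith
  have t2 : d₁ / 2 + φ - ν ≤ Real.arccos (ρ₁ / R) := by linarith
  generalize d₁ / 2 + φ - ν = θ at *
  have lo : ρ₁ ≤ R * Real.cos θ := by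
    rw [← hcA]
    exact mul_le_mul_of_nonneg_left
      (Real.cos_le_cos_of_nonneg_of_le_pi (by linarith) (by linarith) t2) hRpos.le
  refine ⟨rfl, rfl, lo, ?_, ?_, ?_⟩
  · rw [← hRc]
    exact mul_le_mul_of_nonneg_left
      (Real.cos_le_cos_of_nonneg_of_le_pi (by linarith) (by linarith) t1) hRpos.le
  · rw [← hRs]
    exact mul_le_mul_of_nonneg_left
      (Real.sin_le_sin_of_le_of_le_pi_div_two (by linarith) (by linarith) t1) hRpos.le
  · apply Real.le_sqrt_of_sq_le
    have e : (R * Real.sin θ) ^ 2 = R ^ 2 - (R * Real.cos θ) ^ 2 := by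
      rw [mul_pow, Real.sin_sq]; ring
    have := pow_le_pow_left₀ hρ₁0 lo 2
    linarith
end

section
/- Let a and b be real numbers with 0 < a ≤ b, let α ∈ [0, 1], and let ξ ∈ ℝ. Then √(a² sinh²ξ + b² cosh²ξ) / (a² cosh²ξ + b² sinh²ξ)^{(1+α)/2} ≤ (b/a) · (2/a)^α · e^{−α|ξ|}. -/
/-- The bound `|z'(ξ)|/|z(ξ)|^{1+α} ≤ (b/a)(2/a)^α e^{-α|ξ|}` for the hyperbola
parametrization `z(ξ) = a cosh ξ - i b sinh ξ`, where `0 < a ≤ b` and `α ∈ [0,1]`. -/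
theorem stmt_11 (a b α ξ : ℝ) (ha : 0 < a) (hab : a ≤ b) (hα : α ∈ Set.Icc (0 : ℝ) 1) :
    Real.sqrt (a ^ 2 * Real.sinh ξ ^ 2 + b ^ 2 * Real.cosh ξ ^ 2) /
        (a ^ 2 * Real.cosh ξ ^ 2 + b ^ 2 * Real.sinh ξ ^ 2) ^ ((1 + α) / 2)
      ≤ b / a * (2 / a) ^ α * Real.exp (-α * |ξ|) := by
  obtain ⟨hα0, hα1⟩ := hα
  have hb : 0 < b := lt_of_lt_of_le ha hab
  have hc : 0 < Real.cosh ξ := Real.cosh_pos ξ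
  have hab2 : a ^ 2 ≤ b ^ 2 := by gcongr
  set c := Real.cosh ξ with hcdef
  set s := Real.sinh ξ with hsdef
  have hQ : 0 < a ^ 2 * c ^ 2 + b ^ 2 * s ^ 2 := by positivity
  set Q := a ^ 2 * c ^ 2 + b ^ 2 * s ^ 2 with hQdef
  have hsQ : 0 < Real.sqrt Q := Real.sqrt_pos.mpr hQ
  have h1 : Real.sqrt (a ^ 2 * s ^ 2 + b ^ 2 * c ^ 2) ≤ b / a * Real.sqrt Q := by
    apply Real.sqrt_le_iff.mpr
    refine ⟨by positivity, ?_⟩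
    rw [mul_pow, Real.sq_sqrt hQ.le, div_pow, div_mul_eq_mul_div, le_div_iff₀ (by positivity), hQdef]
    have h4 : a ^ 2 * a ^ 2 ≤ b ^ 2 * b ^ 2 := by gcongr
    have := mul_le_mul_of_nonneg_right h4 (sq_nonneg s)
    nlinarith
  have he : Real.exp |ξ| / 2 ≤ c := by
    rw [hcdef, ← Real.cosh_abs, Real.cosh_eq]
    have := Real.exp_pos (-|ξ|)
    linarith
  have h2 : a * Real.exp |ξ| / 2 ≤ Real.sqrt Q := by
    apply Real.le_sqrt_of_sq_le
    have h3 : a * Real.exp |ξ| / 2 ≤ a * c := by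
      rw [mul_div_assoc]; gcongr
    calc (a * Real.exp |ξ| / 2) ^ 2 ≤ (a * c) ^ 2 := by gcongr
      _ ≤ Q := by rw [hQdef, mul_pow]; nlinarith [mul_nonneg (sq_nonneg b) (sq_nonneg s)]
  have hr : 0 < a * Real.exp |ξ| / 2 := by positivity
  have h3 : Q ^ ((1 + α) / 2) = Real.sqrt Q * Real.sqrt Q ^ α := by
    rw [Real.sqrt_eq_rpow, ← Real.rpow_mul hQ.le, ← Real.rpow_add hQ]
    congr 1; ring
  have h5 : (a * Real.exp |ξ| / 2) ^ α ≤ Real.sqrt Q ^ α := Real.rpow_le_rpow hr.le h2 hα0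
  have h6 : (2 / a) ^ α * Real.exp (-α * |ξ|) * (a * Real.exp |ξ| / 2) ^ α = 1 := by
    have : Real.exp (-α * |ξ|) = Real.exp (-|ξ|) ^ α := by
      rw [← Real.exp_mul]; congr 1; ring
    rw [this, ← Real.mul_rpow (by positivity) (by positivity),
      ← Real.mul_rpow (by positivity) (by positivity), Real.exp_neg]
    have : 2 / a * (Real.exp |ξ|)⁻¹ * (a * Real.exp |ξ| / 2) = 1 := by
      have := Real.exp_pos |ξ|
      field_simp
    rw [this, Real.one_rpow]
  rw [h3, div_le_iff₀ (by positivity)]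
  have h7 : 1 ≤ (2 / a) ^ α * Real.exp (-α * |ξ|) * Real.sqrt Q ^ α := by
    rw [← h6]; gcongr
  calc _ ≤ b / a * Real.sqrt Q := h1
    _ = b / a * Real.sqrt Q * 1 := by ring
    _ ≤ b / a * Real.sqrt Q * ((2 / a) ^ α * Real.exp (-α * |ξ|) * Real.sqrt Q ^ α) := by gcongr
    _ = _ := by ring
end
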